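/- arXiv:0808.0890 — 2 statements merged into one kernel-verified Lean document; each statement's English description precedes it below -/
import Mathlib

section
/- Fix n ≥ 1 and for i = 1, …, n define s_i : ℝⁿ → ℝⁿ by s_i(x₁,…,x_n) = (x₁,…,x_{i−1}, −x_i + x_{i−1} + x_{i+1} + 1, x_{i+1},…,x_n), with the conventions x₀ = 0 and x_{n+1} = 0. Then the maps s_i satisfy the Coxeter relations of the symmetric group S_{n+1}: s_i ∘ s_i = id for all i; (s_i ∘ s_j)² = id whenever |i − j| ≥ 2; and (s_i ∘ s_{i+1})³ = id for 1 ≤ i ≤ n−1. -/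
/-- Extension of `x : Fin n → ℝ` by zero to all integer indices (0-indexed), encoding
the conventions `x₀ = 0`, `x_{n+1} = 0`. -/
noncomputable def padR (n : ℕ) (x : Fin n → ℝ) (k : ℤ) : ℝ :=
  if h : 0 ≤ k ∧ k < n then x ⟨k.toNat, by omega⟩ else 0

/-- The reflection `s_i` replacing the `i`-th coordinate by
`-xᵢ + x_{i-1} + x_{i+1} + 1`, with the conventions `x₀ = 0`, `x_{n+1} = 0`
(0-indexed via zero-padding). -/
noncomputable def sR (n : ℕ) (i : Fin n) (x : Fin n → ℝ) : Fin n → ℝ :=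
  fun k => if k = i
    then -x i + padR n x ((i : ℤ) - 1) + padR n x ((i : ℤ) + 1) + 1
    else x k

theorem padR_coe (n : ℕ) (x : Fin n → ℝ) (k : Fin n) : padR n x (k : ℤ) = x k := by
  simp [padR]

theorem padR_injective (n : ℕ) : Function.Injective (padR n) := by
  intro x y h
  funext k
  rw [← padR_coe n x k, h, padR_coe]

/-- The zero-padding of `sR n i x` is obtained by reflecting the padded sequence at `i`. -/
theorem padR_sR (n : ℕ) (i : Fin n) (x : Fin n → ℝ) (k : ℤ) :
    padR n (sR n i x) k =
      if k = (i : ℤ) then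
        -padR n x (i : ℤ) + padR n x ((i : ℤ) - 1) + padR n x ((i : ℤ) + 1) + 1
      else padR n x k := by
  by_cases hk : 0 ≤ k ∧ k < n
  · obtain ⟨m, rfl⟩ : ∃ m : Fin n, k = (m : ℤ) :=
      ⟨⟨k.toNat, by omega⟩, (Int.toNat_of_nonneg hk.1).symm⟩
    simp only [padR_coe, sR, Nat.cast_inj, Fin.val_inj]
  · have hki : k ≠ (i : ℤ) := by
      have := i.isLt
      omega
    rw [if_neg hki, padR, padR, dif_neg hk, dif_neg hk]

/-- the reflections `s₁, …, s_n` satisfy the Coxeter relations of the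
symmetric group `S_{n+1}`: `sᵢ² = id`, `(sᵢ sⱼ)² = id` for `|i - j| ≥ 2`, and
`(sᵢ s_{i+1})³ = id`. -/
theorem reflections_satisfy_coxeter_relations (n : ℕ) (hn : 1 ≤ n) :
    (∀ i : Fin n, sR n i ∘ sR n i = id) ∧
    (∀ i j : Fin n, (i : ℕ) + 2 ≤ (j : ℕ) ∨ (j : ℕ) + 2 ≤ (i : ℕ) →
      (sR n i ∘ sR n j) ∘ (sR n i ∘ sR n j) = id) ∧
    (∀ (i : Fin n) (h : (i : ℕ) + 1 < n),
      (sR n i ∘ sR n ⟨(i : ℕ) + 1, h⟩) ∘ (sR n i ∘ sR n ⟨(i : ℕ) + 1, h⟩)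
        ∘ (sR n i ∘ sR n ⟨(i : ℕ) + 1, h⟩) = id) := by
  refine ⟨fun i => ?_, fun i j hij => ?_, fun i h => ?_⟩
  · funext x
    apply padR_injective
    funext k
    simp only [Function.comp_apply, id_eq, padR_sR]
    grind
  · have h₁ : (i : ℤ) ≠ j ∧ (i : ℤ) - 1 ≠ j ∧ (i : ℤ) + 1 ≠ j := by omega
    have h₂ : (j : ℤ) ≠ i ∧ (j : ℤ) - 1 ≠ i ∧ (j : ℤ) + 1 ≠ i := by omega
    funext x
    apply padR_injective
    funext k
    simp only [Function.comp_apply, id_eq, padR_sR, h₁, h₂, if_false, if_true]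
    grind
  · have h₁ : (i : ℤ) + 1 + 1 ≠ i := by omega
    have h₂ : (i : ℤ) - 1 ≠ i + 1 := by omega
    funext x
    apply padR_injective
    funext k
    simp only [Function.comp_apply, id_eq, padR_sR, Nat.cast_add, Nat.cast_one,
      add_sub_cancel_right, h₁, h₂, left_eq_add, add_eq_left, sub_eq_self, one_ne_zero,
      if_false, if_true]
    split_ifs with h₃ h₄
    · rw [h₃]; ring
    · rw [h₄]; ring
    · rfl
end

section
/- The set of integer solutions (x, y, z) ∈ ℤ³ of the equation x² + y² + z² = xy + yz + x + y + z is exactly the 24-element set {(0,0,0), (1,0,0), (0,1,0), (0,0,1), (1,2,0), (2,1,0), (1,0,1), (0,1,2), (0,2,1), (2,2,0), (1,2,3), (2,1,2), (1,3,1), (3,2,1), (0,2,2), (2,2,3), (1,3,3), (2,4,2), (3,3,1), (3,2,2), (2,4,3), (3,3,3), (3,4,2), (3,4,3)}. -/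
/-- the integer points of the ellipsoid
`x² + y² + z² = xy + yz + x + y + z` are exactly the 24 listed points
(the orbit of the origin under the Weyl group `S₄`). -/
theorem integer_points_ellipsoid_n4 :
    {p : ℤ × ℤ × ℤ |
        p.1 ^ 2 + p.2.1 ^ 2 + p.2.2 ^ 2
          = p.1 * p.2.1 + p.2.1 * p.2.2 + p.1 + p.2.1 + p.2.2}
      = {(0, 0, 0), (1, 0, 0), (0, 1, 0), (0, 0, 1), (1, 2, 0), (2, 1, 0),
         (1, 0, 1), (0, 1, 2), (0, 2, 1), (2, 2, 0), (1, 2, 3), (2, 1, 2),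
         (1, 3, 1), (3, 2, 1), (0, 2, 2), (2, 2, 3), (1, 3, 3), (2, 4, 2),
         (3, 3, 1), (3, 2, 2), (2, 4, 3), (3, 3, 3), (3, 4, 2), (3, 4, 3)} := by
  ext ⟨x, y, z⟩
  simp only [Set.mem_ofPred_eq, Set.mem_insert_iff, Set.mem_singleton_iff, Prod.mk.injEq]
  constructor
  · intro h
    have key : (2 * x - y - 1) ^ 2 + (2 * z - y - 1) ^ 2 + 2 * (y - 2) ^ 2 = 10 := by
      linear_combination 4 * h
    have hy₀ : 0 ≤ y := by nlinarith [sq_nonneg (2 * x - y - 1), sq_nonneg (2 * z - y - 1)]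
    have hy₁ : y ≤ 4 := by nlinarith [sq_nonneg (2 * x - y - 1), sq_nonneg (2 * z - y - 1)]
    obtain ⟨hx₀, hx₁⟩ := abs_le.mp (abs_le_of_sq_le_sq (a := 2 * x - y - 1) (b := 4)
      (by nlinarith [sq_nonneg (2 * z - y - 1), sq_nonneg (y - 2)]) (by norm_num))
    obtain ⟨hz₀, hz₁⟩ := abs_le.mp (abs_le_of_sq_le_sq (a := 2 * z - y - 1) (b := 4)
      (by nlinarith [sq_nonneg (2 * x - y - 1), sq_nonneg (y - 2)]) (by norm_num))
    clear key
    interval_cases y <;>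
    · have hx_lower : -1 ≤ x := by omega
      have hx_upper : x ≤ 4 := by omega
      have hz_lower : -1 ≤ z := by omega
      have hz_upper : z ≤ 4 := by omega
      interval_cases x <;> interval_cases z <;> simp_all
  · intro h
    rcases h with h | h | h | h | h | h | h | h | h | h | h | h | h | h | h | h | h | h | h | h |
      h | h | h | h <;> obtain ⟨rfl, rfl, rfl⟩ := h <;> norm_num
end
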